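/- arXiv:1304.3543 — 3 statements merged into one kernel-verified Lean document; each statement's English description precedes it below -/
import Mathlib

section
/- Let 0 < θ < π and define F(s) = (Z(s+1, e^{iθ}) − Z(s+1, e^{−iθ}))/(2i·sin θ) for s ∈ ℂ. Then the derivative of F at s = −2 equals (1/(4π·sin θ))·(ζ(2, θ/(2π)) − π²/(2·sin²(θ/2))), where ζ(s, x) is the Hurwitz zeta function; moreover this value is a positive real number. -/
open Complex HurwitzZeta

lemma aux_bound {z : ℂ} (h : z ∈ Metric.ball (1/4 : ℂ) (1/4)) : 0 < z.re ∧ z.re < 1/2 := by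
  rw [Metric.mem_ball, dist_eq_norm] at h
  have h1 := (Complex.abs_re_le_norm (z - 1/4)).trans_lt h
  have h2 : (z - 1/4).re = z.re - 1/4 := by
    rw [show (1/4 : ℂ) = ((1/4 : ℝ) : ℂ) by push_cast; rfl]; simp
  rw [h2, abs_lt] at h1
  constructor <;> linarith

lemma aux_sub {z : ℂ} (h : z ∈ Metric.ball (1/4 : ℂ) (1/4)) (n : ℕ) :
    (n + 1/2 : ℝ) ≤ ‖z - (n + 1)‖ := by
  obtain ⟨h0, h1⟩ := aux_bound h
  refine le_trans ?_ (Complex.abs_re_le_norm _)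
  have : (z - (n + 1)).re = z.re - (n + 1) := by simp
  rw [this]
  refine le_trans ?_ (neg_le_abs _)
  linarith

lemma aux_add {z : ℂ} (h : z ∈ Metric.ball (1/4 : ℂ) (1/4)) (n : ℕ) :
    (n + 1/2 : ℝ) ≤ ‖z + (n + 1)‖ := by
  obtain ⟨h0, h1⟩ := aux_bound h
  refine le_trans ?_ (Complex.abs_re_le_norm _)
  have : (z + (n + 1)).re = z.re + (n + 1) := by simp
  rw [this]
  refine le_trans ?_ (le_abs_self _)
  linarith

lemma aux_int {z : ℂ} (h : z ∈ Metric.ball (1/4 : ℂ) (1/4)) : z ∈ Complex.integerComplement := by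
  obtain ⟨h0, h1⟩ := aux_bound h
  rintro ⟨m, rfl⟩
  simp only [intCast_re] at h0 h1
  have h0' : 0 < m := by exact_mod_cast h0
  have : (1 : ℝ) ≤ m := by exact_mod_cast h0'
  linarith

lemma aux_norm {w : ℂ} {n : ℕ} (h : (n + 1/2 : ℝ) ≤ ‖w‖) :
    ‖-(w ^ 2)⁻¹‖ ≤ 4 * (1 / ((n + 1 : ℕ) : ℝ) ^ 2) := by
  rw [norm_neg, norm_inv, norm_pow]
  have h1 : ((n + 1 : ℕ) : ℝ) / 2 ≤ ‖w‖ := by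
    push_cast
    have : (0 : ℝ) ≤ n := n.cast_nonneg
    linarith
  have h2 : (((n + 1 : ℕ) : ℝ) / 2) ^ 2 ≤ ‖w‖ ^ 2 := by gcongr
  calc (‖w‖ ^ 2)⁻¹ ≤ ((((n + 1 : ℕ) : ℝ) / 2) ^ 2)⁻¹ := by gcongr
    _ = _ := by
      have : ((n + 1 : ℕ) : ℝ) ≠ 0 := by positivity
      field_simp; norm_num

lemma aux_ne {w : ℂ} {n : ℕ} (h : (n + 1/2 : ℝ) ≤ ‖w‖) : w ≠ 0 := by
  rw [← norm_pos_iff]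
  have : (0 : ℝ) ≤ n := n.cast_nonneg
  linarith

lemma aux_deriv {z : ℂ} (h : z ∈ Metric.ball (1/4 : ℂ) (1/4)) :
    ∑' n : ℕ, (-((z - (n + 1)) ^ 2)⁻¹ + -((z + (n + 1)) ^ 2)⁻¹)
      = - Real.pi ^ 2 / Complex.sin (Real.pi * z) ^ 2 + 1 / z ^ 2 := by
  have hsum : Summable (fun n : ℕ => 4 * (1 / ((n + 1 : ℕ) : ℝ) ^ 2)
      + 4 * (1 / ((n + 1 : ℕ) : ℝ) ^ 2)) := by
    have := (summable_nat_add_iff 1).mpr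
      ((Real.summable_one_div_nat_pow (p := 2)).mpr (by norm_num))
    exact (this.mul_left 4).add (this.mul_left 4)
  have h1 := hasDerivAt_tsum_of_isPreconnected
    (g := fun (n : ℕ) (z : ℂ) => 1 / (z - (n + 1)) + 1 / (z + (n + 1)))
    (g' := fun (n : ℕ) (z : ℂ) => -((z - (n + 1)) ^ 2)⁻¹ + -((z + (n + 1)) ^ 2)⁻¹)
    (t := Metric.ball (1/4 : ℂ) (1/4)) hsum Metric.isOpen_ball
    (convex_ball _ _).isPreconnected ?_ ?_ h (summable_cotTerm (aux_int h)) h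
  · have hz0 : z ≠ 0 := by
      rintro rfl
      have := (aux_bound h).1
      simp at this
    have hs : Complex.sin (Real.pi * z) ≠ 0 := sin_pi_mul_ne_zero (aux_int h)
    have h2 : HasDerivAt (fun x : ℂ => Real.pi * cot (Real.pi * x) - 1 / x)
        (- Real.pi ^ 2 / Complex.sin (Real.pi * z) ^ 2 + 1 / z ^ 2) z := by
      have hl : HasDerivAt (fun x : ℂ => (Real.pi : ℂ) * x) (Real.pi : ℂ) z := by
        simpa using (hasDerivAt_id z).const_mul (Real.pi : ℂ)
      have hcot := ((hl.ccos.div hl.csin hs).const_mul (Real.pi : ℂ)).sub (hasDerivAt_inv hz0)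
      refine (hcot.congr_deriv ?_).congr_of_eventuallyEq (.of_forall fun x => ?_)
      · have := Complex.sin_sq_add_cos_sq (Real.pi * z)
        field_simp
        linear_combination (-(Real.pi : ℂ) ^ 2 * z ^ 2) * this
      · simp [Complex.cot]
    refine h1.unique (h2.congr_of_eventuallyEq ?_)
    filter_upwards [Metric.isOpen_ball.mem_nhds h] with y hy
    exact (cot_series_rep' (aux_int hy)).symm
  · intro n y hy
    have e1 := ((hasDerivAt_id y).sub_const ((n : ℂ) + 1)).inv (aux_ne (aux_sub hy n))
    have e2 := ((hasDerivAt_id y).add_const ((n : ℂ) + 1)).inv (aux_ne (aux_add hy n))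
    refine ((e1.add e2).congr_deriv ?_).congr_of_eventuallyEq (.of_forall fun x => ?_)
    · simp [neg_div]
    · simp
  · intro n y hy
    exact norm_add_le_of_le (aux_norm (aux_sub hy n)) (aux_norm (aux_add hy n))

lemma aux_even {a : ℝ} (h0 : 0 < a) (h1 : a < 1/2) :
    hurwitzZetaEven (a : UnitAddCircle) 2 =
      (Real.pi : ℂ) ^ 2 / (2 * Complex.sin (Real.pi * a) ^ 2) := by
  have hb : (a : ℂ) ∈ Metric.ball (1/4 : ℂ) (1/4) := by
    rw [Metric.mem_ball, dist_eq_norm,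
      show (a : ℂ) - 1/4 = ((a - 1/4 : ℝ) : ℂ) by push_cast; rfl, norm_real, Real.norm_eq_abs,
      abs_lt]
    constructor <;> linarith
  have hmem : a ∈ Set.Icc (0 : ℝ) 1 := ⟨h0.le, by linarith⟩
  have hE := hasSum_nat_hurwitzZetaEven_of_mem_Icc hmem (s := 2) (by norm_num)
  have hZ := hasSum_hurwitzZeta_of_one_lt_re hmem (s := 2) (by norm_num)
  have hZ1 := (hasSum_nat_add_iff' 1).mpr hZ
  have hD := (((hE.mul_left 2).sub hZ).add hZ1).neg
  have key := aux_deriv hb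
  have : HasSum (fun n : ℕ => -(((a : ℂ) - (n + 1)) ^ 2)⁻¹ + -(((a : ℂ) + (n + 1)) ^ 2)⁻¹)
      (-(2 * hurwitzZetaEven (a : UnitAddCircle) 2 - hurwitzZeta (a : UnitAddCircle) 2 +
        (hurwitzZeta (a : UnitAddCircle) 2 -
          ∑ i ∈ Finset.range 1, 1 / ((i : ℂ) + (a : ℂ)) ^ (2 : ℂ)))) := by
    refine hD.congr_fun fun n => ?_
    have e (x : ℂ) : x ^ (2 : ℂ) = x ^ 2 := by exact_mod_cast Complex.cpow_natCast x 2
    simp only [e]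
    push_cast
    rw [show ((a : ℂ) - (n + 1)) ^ 2 = (n + 1 - a) ^ 2 by ring, add_comm (a : ℂ)]
    ring
  rw [this.tsum_eq] at key
  have e (x : ℂ) : x ^ (2 : ℂ) = x ^ 2 := by exact_mod_cast Complex.cpow_natCast x 2
  simp only [e, Finset.sum_range_one, Nat.cast_zero, zero_add] at key
  rw [mul_comm (2 : ℂ), ← div_div]
  linear_combination (-1/2) * key

lemma aux_odd {a : ℝ} (h0 : 0 < a) (h1 : a < 1/2) :
    ∃ r : ℝ, 0 < r ∧ hurwitzZetaOdd (a : UnitAddCircle) 2 = r := by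
  have hmem : a ∈ Set.Icc (0 : ℝ) 1 := ⟨h0.le, by linarith⟩
  have hO := hasSum_nat_hurwitzZetaOdd_of_mem_Icc hmem (s := 2) (by norm_num)
  have e (x : ℂ) : x ^ (2 : ℂ) = x ^ 2 := by exact_mod_cast Complex.cpow_natCast x 2
  have hO' : HasSum (fun n : ℕ => (((1 / (n + a) ^ 2 - 1 / (n + 1 - a) ^ 2) / 2 : ℝ) : ℂ))
      (hurwitzZetaOdd (a : UnitAddCircle) 2) := by
    refine hO.congr_fun fun n => ?_
    simp only [e]
    push_cast
    rfl
  have hs := Complex.hasSum_re hO'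
  simp only [ofReal_re] at hs
  have hpos (n : ℕ) : 0 < (1 / (n + a) ^ 2 - 1 / (n + 1 - a) ^ 2) / 2 := by
    have hn : (0 : ℝ) ≤ n := n.cast_nonneg
    have : 1 / (n + 1 - a) ^ 2 < 1 / (n + a) ^ 2 := by
      apply one_div_lt_one_div_of_lt (by positivity)
      gcongr ?_ ^ 2
      linarith
    linarith
  refine ⟨_, ?_, hO'.unique (Complex.hasSum_ofReal.mpr hs)⟩
  rw [← hs.tsum_eq]
  exact hs.summable.tsum_pos (fun n => (hpos n).le) 0 (hpos 0)

lemma aux_sinZeta (a : UnitAddCircle) :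
    HasDerivAt (fun s : ℂ => sinZeta a (s + 1)) (hurwitzZetaOdd a 2 / (4 * Real.pi)) (-2) := by
  have hpi : (Real.pi : ℂ) ≠ 0 := ofReal_ne_zero.mpr Real.pi_ne_zero
  have hsin : HasDerivAt (fun s : ℂ => Complex.sin (Real.pi * (-s) / 2)) (Real.pi / 2) (-2) := by
    have hl : HasDerivAt (fun s : ℂ => (Real.pi : ℂ) * (-s) / 2) (-Real.pi / 2) (-2) := by
      simpa using ((hasDerivAt_id (-2 : ℂ)).neg.const_mul (Real.pi : ℂ)).div_const 2
    refine hl.csin.congr_deriv ?_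
    rw [show (Real.pi : ℂ) * (- -2) / 2 = Real.pi by ring, Complex.cos_pi]
    ring
  have hG : DifferentiableAt ℂ
      (fun s : ℂ => 2 * (2 * (Real.pi : ℂ)) ^ s * Gamma (-s) * hurwitzZetaOdd a (-s)) (-2) := by
    have g1 : DifferentiableAt ℂ (fun s : ℂ => (2 * (Real.pi : ℂ)) ^ s) (-2) :=
      differentiableAt_id.const_cpow (Or.inl (mul_ne_zero two_ne_zero hpi))
    have g2 : DifferentiableAt ℂ (fun s : ℂ => Gamma (-s)) (-2) := by
      refine DifferentiableAt.comp (g := Gamma) (-2 : ℂ) ?_ differentiableAt_id.neg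
      refine differentiableAt_Gamma _ fun m hm => ?_
      have := congrArg Complex.re hm
      simp at this
      have hn : (0 : ℝ) ≤ m := m.cast_nonneg
      linarith
    have g3 : DifferentiableAt ℂ (fun s : ℂ => hurwitzZetaOdd a (-s)) (-2) :=
      DifferentiableAt.comp (g := hurwitzZetaOdd a) (-2 : ℂ) (differentiable_hurwitzZetaOdd a _)
        differentiableAt_id.neg
    exact ((g1.const_mul 2).mul g2).mul g3
  have hP := hG.hasDerivAt.mul hsin
  refine (hP.congr_deriv ?_).congr_of_eventuallyEq ?_
  · rw [show (Real.pi : ℂ) * (- -2) / 2 = Real.pi by ring, Complex.sin_pi, neg_neg]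
    have e : (2 * (Real.pi : ℂ)) ^ (-2 : ℂ) = ((2 * (Real.pi : ℂ)) ^ 2)⁻¹ := by
      rw [Complex.cpow_neg]
      congr 1
      exact_mod_cast Complex.cpow_natCast (2 * (Real.pi : ℂ)) 2
    rw [e, Complex.Gamma_ofNat_eq_factorial]
    simp
    field_simp
    ring
  · have hre : {s : ℂ | s.re < 0} ∈ nhds (-2 : ℂ) :=
      (isOpen_lt Complex.continuous_re continuous_const).mem_nhds (by simp)
    filter_upwards [hre] with s hs
    have := sinZeta_one_sub a (s := -s) (fun n hn => by
      have h1 := congrArg Complex.re hn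
      simp at h1
      have h2 : s.re < 0 := hs
      have hn : (0 : ℝ) ≤ n := n.cast_nonneg
      linarith)
    rw [show s + 1 = 1 - (-s) by ring, this]
    simp only [neg_neg, Pi.mul_apply]
    ring

/-- The derivative at `s = -2` of the Witten L-function of `SU(2)` at a regular element
with eigenvalues `e^{±iθ}`, `0 < θ < π`, equals
`(1/(4π sin θ)) (ζ(2, θ/(2π)) - π²/(2 sin²(θ/2)))`, and this value is a positive real. -/
theorem witten_SU2_L_deriv_at_neg_two (θ : ℝ) (hθ0 : 0 < θ) (hθπ : θ < Real.pi)
    (F : ℂ → ℂ)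
    (hF : ∀ s : ℂ, F s =
      (expZeta ((θ / (2 * Real.pi) : ℝ) : UnitAddCircle) (s + 1)
          - expZeta ((1 - θ / (2 * Real.pi) : ℝ) : UnitAddCircle) (s + 1))
        / (2 * I * (Real.sin θ : ℂ))) :
    deriv F (-2) = 1 / (4 * Real.pi * Real.sin θ)
        * (hurwitzZeta ((θ / (2 * Real.pi) : ℝ) : UnitAddCircle) 2
            - (Real.pi : ℂ) ^ 2 / (2 * (Real.sin (θ / 2) : ℂ) ^ 2)) ∧
    (deriv F (-2)).im = 0 ∧ 0 < (deriv F (-2)).re := by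
  have hpi := Real.pi_pos
  have hsin : 0 < Real.sin θ := Real.sin_pos_of_pos_of_lt_pi hθ0 hθπ
  obtain ⟨a, ha⟩ : ∃ a, a = θ / (2 * Real.pi) := ⟨_, rfl⟩
  have h0 : 0 < a := by rw [ha]; positivity
  have h1 : a < 1/2 := by
    rw [ha, div_lt_div_iff₀ (by positivity) (by norm_num)]; linarith
  have hpa : (Real.pi : ℂ) * a = ((θ / 2 : ℝ) : ℂ) := by
    rw [← ofReal_mul, ha]; congr 1; field_simp
  rw [← ha] at hF ⊢
  have hneg : ((1 - a : ℝ) : UnitAddCircle) = -(a : UnitAddCircle) := by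
    rw [AddCircle.coe_sub, AddCircle.coe_period, zero_sub]
  have hF' : F = fun s => sinZeta (a : UnitAddCircle) (s + 1) / (Real.sin θ : ℂ) := by
    funext s
    rw [hF s, hneg, sinZeta_eq, div_div]
  have hd : deriv F (-2) =
      hurwitzZetaOdd (a : UnitAddCircle) 2 / (4 * Real.pi) / (Real.sin θ : ℂ) := by
    rw [hF']
    exact ((aux_sinZeta (a : UnitAddCircle)).div_const _).deriv
  obtain ⟨r, hr, hor⟩ := aux_odd h0 h1
  constructor
  · rw [hd, hurwitzZeta, aux_even h0 h1, hpa, ← ofReal_sin]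
    rw [add_sub_cancel_left, div_div]
    ring
  · have : deriv F (-2) = ((r / (4 * Real.pi) / Real.sin θ : ℝ) : ℂ) := by
      rw [hd, hor]; push_cast; rfl
    rw [this, ofReal_im, ofReal_re]
    exact ⟨rfl, by positivity⟩
end

section
/- For every positive even integer n, Σ_{k=0}^{n} (1/(k!·(n−k)!))·ζ(−n−k)·ζ(−2n+k) = (n!/(2n+1)!)·ζ(−3n−1), where ζ is the Riemann zeta function. -/
open Complex
namespace ZetaNeg
open Polynomial Finset

/-- Normalised Bernoulli coefficient, with the index-one term removed. -/
noncomputable def cc (m : ℕ) : ℚ := if m = 1 then 0 else _root_.bernoulli m / (m.factorial : ℚ)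

/-- Coefficient of `Y^q` in `(Y (1+Y))^n`. -/
def ch (n q : ℕ) : ℚ := if n ≤ q then (n.choose (q - n) : ℚ) else 0

lemma ch_symm {n p q : ℕ} (h : p + q = 3 * n) : ch n p = ch n q := by
  unfold ch
  by_cases h1 : n ≤ q <;> by_cases h2 : n ≤ p <;> simp only [h1, h2, if_true, if_false]
  · have : p - n = n - (q - n) ∨ n < p - n ∧ n = q := by omega
    rcases Nat.lt_or_ge n (q - n) with h3 | h3
    · omega
    · rw [show p - n = n - (q - n) by omega, Nat.choose_symm h3]
  · rw [Nat.choose_eq_zero_of_lt (by omega)]; simp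
  · rw [Nat.choose_eq_zero_of_lt (by omega)]; simp

lemma alt_sum (n q : ℕ) (hn : Even n) :
    ∑ l ∈ range (n + 1), (-1 : ℚ) ^ l * n.choose l * (n + l).choose q = ch n q := by
  have h : (∑ l ∈ range (n + 1), Polynomial.C ((-1 : ℚ) ^ l * n.choose l) * (X + 1) ^ (n + l))
      = (X + 1) ^ n * X ^ n := by
    have h1 : (X : ℚ[X]) ^ n = (-(X + 1) + 1) ^ n := by
      rw [show (-(X + 1) + 1 : ℚ[X]) = - X by ring, hn.neg_pow]
    rw [h1, add_pow (-(X + 1) : ℚ[X]), mul_sum]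
    refine sum_congr rfl fun l _ => ?_
    rw [neg_pow (X + 1 : ℚ[X]), pow_add]
    simp
    ring
  have h2 := congrArg (fun f => f.coeff q) h
  simp only [finsetSum_coeff, coeff_C_mul, coeff_X_add_one_pow, coeff_mul_X_pow'] at h2
  rw [h2, ch]

lemma alt_sum' (n q : ℕ) (hn : Even n) :
    ∑ l ∈ range (n + 1), (-1 : ℚ) ^ l * n.choose l * (2 * n - l).choose q = ch n q := by
  rw [← alt_sum n q hn, ← sum_range_reflect]
  refine sum_congr rfl fun l hl => ?_
  have hl' : l ≤ n := by simpa [Nat.lt_succ_iff] using hl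
  rw [show n + 1 - 1 - l = n - l by omega, Nat.choose_symm hl',
    show 2 * n - (n - l) = n + l by omega]
  congr 2
  have : Even (n - l) ↔ Even l := by
    rw [Nat.even_sub hl']; tauto
  by_cases h : Even l
  · rw [h.neg_one_pow, (this.2 h).neg_one_pow]
  · rw [(Nat.not_even_iff_odd.1 h).neg_one_pow,
      (Nat.not_even_iff_odd.1 (fun h' => h (this.1 h'))).neg_one_pow]

/-- The weights. -/
def ww (n l : ℕ) : ℚ :=
  (-1) ^ l * n.choose l * ((n + l).factorial * (2 * n - l).factorial)

lemma ph1 {n p q : ℕ} (hn : Even n) (h : p + q = 3 * n) :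
    ∑ l ∈ range (n + 1), ww n l * ((X : ℚ[X]) ^ p).coeff (n + l)
      = (-1) ^ p * (p.factorial * q.factorial * ch n p) := by
  simp only [coeff_X_pow]
  unfold ch
  by_cases h1 : n ≤ p
  · obtain ⟨k, rfl⟩ := Nat.exists_eq_add_of_le h1
    simp only [add_right_inj, mul_ite, mul_one, mul_zero, sum_ite_eq', mem_range]
    have h2 : q = 2 * n - k := by omega
    split_ifs with h3
    · rw [ww, h2, pow_add, hn.neg_one_pow]
      simp; ring
    · rw [Nat.choose_eq_zero_of_lt (by omega)]; simp
  · rw [if_neg h1, sum_eq_zero]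
    · simp
    · intro l _
      rw [if_neg (by omega)]; simp

lemma ph2 {n p q : ℕ} (hn : Even n) (h : p + q = 3 * n) :
    ∑ l ∈ range (n + 1), ww n l * ((X + 1 : ℚ[X]) ^ p * X ^ q).coeff (n + l)
      = p.factorial * q.factorial * ch n q := by
  rw [← alt_sum n q hn, mul_sum]
  refine sum_congr rfl fun l hl => ?_
  have hl' : l ≤ n := by simpa [Nat.lt_succ_iff] using hl
  rw [coeff_mul_X_pow', coeff_X_add_one_pow, ww]
  split_ifs with h1
  · have e1 := Nat.choose_mul_factorial_mul_factorial (show n + l - q ≤ p by omega)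
    have e2 := Nat.choose_mul_factorial_mul_factorial h1
    rw [show p - (n + l - q) = 2 * n - l by omega] at e1
    have e1' : (p.choose (n + l - q) : ℚ) * (n + l - q).factorial * (2 * n - l).factorial
      = p.factorial := by exact_mod_cast e1
    have e2' : ((n + l).choose q : ℚ) * q.factorial * (n + l - q).factorial
      = (n + l).factorial := by exact_mod_cast e2
    rw [← e1', ← e2']; ring
  · rw [Nat.choose_eq_zero_of_lt (show n + l < q by omega)]; simp

lemma ph3 {n p q : ℕ} (hn : Even n) (h : p + q = 3 * n) :
    ∑ l ∈ range (n + 1), ww n l * ((X + 1 : ℚ[X]) ^ p).coeff (n + l)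
      = p.factorial * q.factorial * ch n q := by
  rw [← alt_sum' n q hn, mul_sum]
  refine sum_congr rfl fun l hl => ?_
  have hl' : l ≤ n := by simpa [Nat.lt_succ_iff] using hl
  rw [coeff_X_add_one_pow, ww]
  by_cases h1 : n + l ≤ p
  · have e1 := Nat.choose_mul_factorial_mul_factorial h1
    have e2 := Nat.choose_mul_factorial_mul_factorial (show q ≤ 2 * n - l by omega)
    rw [show 2 * n - l - q = p - (n + l) by omega] at e2
    have e1' : (p.choose (n + l) : ℚ) * (n + l).factorial * (p - (n + l)).factorial
      = p.factorial := by exact_mod_cast e1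
    have e2' : ((2 * n - l).choose q : ℚ) * q.factorial * (p - (n + l)).factorial
      = (2 * n - l).factorial := by exact_mod_cast e2
    rw [← e1', ← e2']; ring
  · rw [Nat.choose_eq_zero_of_lt (show p < n + l by omega),
      Nat.choose_eq_zero_of_lt (show 2 * n - l < q by omega)]; simp

lemma beta_sum (n : ℕ) : ∀ m : ℕ,
    ∑ l ∈ range (n + 1), (-1 : ℚ) ^ l * n.choose l / (m + l + 1)
      = n.factorial * m.factorial / (m + n + 1).factorial := by
  induction n with
  | zero =>
    intro m
    simp [Nat.factorial_succ]
    have := Nat.factorial_ne_zero m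
    field_simp
  | succ n ih =>
    intro m
    have hs : ∑ l ∈ range (n + 1 + 1), (-1 : ℚ) ^ l * (n + 1).choose l / (m + l + 1)
        = ∑ l ∈ range (n + 1), (-1 : ℚ) ^ l * n.choose l / (m + l + 1)
          - ∑ l ∈ range (n + 1), (-1 : ℚ) ^ l * n.choose l / ((m + 1 : ℕ) + l + 1) := by
      have hx : ∑ l ∈ range (n + 1), (-1 : ℚ) ^ l * n.choose l / (m + l + 1)
        = ∑ l ∈ range (n + 1 + 1), (-1 : ℚ) ^ l * n.choose l / (m + l + 1) := by
        rw [sum_range_succ _ (n + 1)]; simp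
      rw [hx, sum_range_succ', sum_range_succ' _ (n + 1), add_sub_right_comm,
        ← sum_sub_distrib]
      congr 1
      · refine sum_congr rfl fun l _ => ?_
        rw [Nat.choose_succ_succ]
        push_cast
        rw [show (m : ℚ) + 1 + l + 1 = m + (l + 1) + 1 by ring]
        ring
      · simp
    rw [hs, ih, ih]
    rw [show m + 1 + n + 1 = (m + n + 1) + 1 by ring, show m + (n + 1) + 1 = (m + n + 1) + 1 by ring,
      Nat.factorial_succ (m + n + 1), Nat.factorial_succ n, Nat.factorial_succ m]
    have := Nat.factorial_ne_zero (m + n + 1)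
    push_cast
    field_simp
    ring

lemma conv_sum (n : ℕ) :
    ∑ l ∈ range (n + 1), (n + l).choose n * (2 * n - l).choose n = (3 * n + 1).choose (2 * n + 1) := by
  have h := PowerSeries.mk_add_choose_mul_one_sub_pow_eq_one ℚ n
  have h2 := PowerSeries.mk_add_choose_mul_one_sub_pow_eq_one ℚ (2 * n + 1)
  set F : PowerSeries ℚ := PowerSeries.mk fun k => ((n + k).choose n : ℚ) with hF
  set G : PowerSeries ℚ := PowerSeries.mk fun k => ((2 * n + 1 + k).choose (2 * n + 1) : ℚ) with hG
  have h3 : F * F = G := by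
    have hne : ((1 - PowerSeries.X : PowerSeries ℚ)) ^ (2 * n + 1 + 1) ≠ 0 := by
      intro h0; rw [h0] at h2; simp at h2
    apply mul_right_cancel₀ hne
    rw [h2, show 2 * n + 1 + 1 = (n + 1) + (n + 1) by ring, pow_add,
      show ∀ a b : PowerSeries ℚ, a * a * (b * b) = (a * b) * (a * b) by intros; ring, h, one_mul]
  have h4 := congrArg (PowerSeries.coeff n) h3
  rw [PowerSeries.coeff_mul, Finset.Nat.sum_antidiagonal_eq_sum_range_succ_mk] at h4
  simp only [hF, hG, PowerSeries.coeff_mk] at h4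
  rw [show 2 * n + 1 + n = 3 * n + 1 by ring] at h4
  have h5 : ∑ l ∈ range (n + 1), (n + l).choose n * (2 * n - l).choose n
    = ∑ l ∈ range (n + 1), (n + l).choose n * (n + (n - l)).choose n := by
    refine sum_congr rfl fun l hl => ?_
    have hl' : l ≤ n := by simpa [Nat.lt_succ_iff] using hl
    rw [show 2 * n - l = n + (n - l) by omega]
  rw [h5]
  exact_mod_cast h4

lemma final_sum {n : ℕ} (hn : Even n) :
    ∑ l ∈ range (n + 1), ww n l * ((3 * n + 2).choose (n + l + 1) + (-1) ^ l)
      = 3 * (n.factorial ^ 2 * (3 * n + 1).factorial / (2 * n + 1).factorial) := by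
  have hA : ∑ l ∈ range (n + 1), ww n l * ((-1) ^ l)
      = n.factorial ^ 2 * (3 * n + 1).factorial / (2 * n + 1).factorial := by
    have e := conv_sum n
    have e1 := Nat.choose_mul_factorial_mul_factorial (show 2 * n + 1 ≤ 3 * n + 1 by omega)
    rw [show 3 * n + 1 - (2 * n + 1) = n by omega, ← e] at e1
    rw [eq_div_iff (by exact_mod_cast Nat.factorial_ne_zero _)]
    have e2 : (∑ l ∈ range (n + 1), ((n + l).choose n : ℚ) * (2 * n - l).choose n)
      * (2 * n + 1).factorial * n.factorial = (3 * n + 1).factorial := by exact_mod_cast e1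
    rw [← e2]
    suffices ∑ l ∈ range (n + 1), ww n l * ((-1) ^ l) = n.factorial ^ 3 *
      ∑ l ∈ range (n + 1), ((n + l).choose n : ℚ) * (2 * n - l).choose n by rw [this]; ring
    rw [mul_sum]
    refine sum_congr rfl fun l hl => ?_
    have hl' : l ≤ n := by simpa [Nat.lt_succ_iff] using hl
    have a1 := Nat.choose_mul_factorial_mul_factorial (show n ≤ n + l by omega)
    have a2 := Nat.choose_mul_factorial_mul_factorial (show n ≤ 2 * n - l by omega)
    have a3 := Nat.choose_mul_factorial_mul_factorial hl'
    rw [show n + l - n = l by omega] at a1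
    rw [show 2 * n - l - n = n - l by omega] at a2
    have a1' : ((n + l).choose n : ℚ) * n.factorial * l.factorial = (n + l).factorial := by
      exact_mod_cast a1
    have a2' : ((2 * n - l).choose n : ℚ) * n.factorial * (n - l).factorial
      = (2 * n - l).factorial := by exact_mod_cast a2
    have a3' : (n.choose l : ℚ) * l.factorial * (n - l).factorial = n.factorial := by
      exact_mod_cast a3
    have s : ((-1 : ℚ) ^ l) * (-1) ^ l = 1 := by rw [← mul_pow]; simp
    rw [ww, ← a1', ← a2']
    linear_combination (n.choose l : ℚ) * (((n + l).choose n : ℚ) * n.factorial * l.factorial) *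
      (((2 * n - l).choose n : ℚ) * n.factorial * (n - l).factorial) * s +
      ((n + l).choose n : ℚ) * ((2 * n - l).choose n : ℚ) * n.factorial ^ 2 * a3'
  have hB : ∑ l ∈ range (n + 1), ww n l * ((3 * n + 2).choose (n + l + 1))
      = 2 * (n.factorial ^ 2 * (3 * n + 1).factorial / (2 * n + 1).factorial) := by
    have b1 := beta_sum n n
    have b2 : ∑ l ∈ range (n + 1), (-1 : ℚ) ^ l * n.choose l / (2 * n - l + 1)
        = n.factorial * n.factorial / (n + n + 1).factorial := by
      rw [← b1, ← sum_range_reflect]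
      refine sum_congr rfl fun l hl => ?_
      have hl' : l ≤ n := by simpa [Nat.lt_succ_iff] using hl
      rw [show n + 1 - 1 - l = n - l by omega, Nat.choose_symm hl']
      have hp : (-1 : ℚ) ^ (n - l) = (-1) ^ l := by
        have h1 : (-1 : ℚ) ^ (n - l) * (-1) ^ l = 1 := by
          rw [← pow_add, Nat.sub_add_cancel hl', hn.neg_one_pow]
        have s : ((-1 : ℚ) ^ l) * (-1) ^ l = 1 := by rw [← mul_pow]; simp
        linear_combination (-1) ^ l * h1 - (-1) ^ (n - l) * s
      rw [hp, Nat.cast_sub hl']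
      congr 1
      ring
    have : ∑ l ∈ range (n + 1), ww n l * ((3 * n + 2).choose (n + l + 1)) =
      (3 * n + 1).factorial * (∑ l ∈ range (n + 1), (-1 : ℚ) ^ l * n.choose l / (n + l + 1)
        + ∑ l ∈ range (n + 1), (-1 : ℚ) ^ l * n.choose l / (2 * n - l + 1)) := by
      rw [← sum_add_distrib, mul_sum]
      refine sum_congr rfl fun l hl => ?_
      have hl' : l ≤ n := by simpa [Nat.lt_succ_iff] using hl
      have a1 := Nat.choose_mul_factorial_mul_factorial (show n + l + 1 ≤ 3 * n + 2 by omega)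
      rw [show 3 * n + 2 - (n + l + 1) = (2 * n - l) + 1 by omega, Nat.factorial_succ (n + l),
        Nat.factorial_succ (2 * n - l), Nat.factorial_succ (3 * n + 1)] at a1
      have a1' : ((3 * n + 2).choose (n + l + 1) : ℚ) * ((n + l + 1) * (n + l).factorial) *
          ((2 * n - l + 1) * (2 * n - l).factorial) = (3 * n + 1 + 1) * (3 * n + 1).factorial := by
        have := congrArg (Nat.cast : ℕ → ℚ) a1
        push_cast [Nat.cast_sub (show l ≤ 2 * n by omega)] at this
        exact this
      have p1 : (n + l + 1 : ℚ) ≠ 0 := by positivity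
      have p2 : (2 * n - l + 1 : ℚ) ≠ 0 := by
        have : (l : ℚ) ≤ n := by exact_mod_cast hl'
        have : (0 : ℚ) ≤ n := by positivity
        intro h; linarith
      rw [ww]
      generalize hy : (2 * n - l + 1 : ℚ) = y at a1' p2 ⊢
      field_simp
      linear_combination (n.choose l : ℚ) * a1' + (n.choose l : ℚ) * (3 * n + 1).factorial * hy
    rw [this, b1, b2, show n + n + 1 = 2 * n + 1 by ring]
    ring
  simp only [mul_add, sum_add_distrib]
  rw [hA, hB]; ring

/-- `2T/(e^T-1) + T`. -/
noncomputable def GG : PowerSeries ℚ[X] :=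
  bernoulliPowerSeries ℚ[X] + bernoulliPowerSeries ℚ[X] + PowerSeries.X

lemma GG_coeff (m : ℕ) : PowerSeries.coeff m GG = Polynomial.C (2 * cc m) := by
  unfold GG cc
  rw [map_add, map_add, bernoulliPowerSeries, PowerSeries.coeff_mk, PowerSeries.coeff_X,
    Polynomial.algebraMap_eq, ← Polynomial.C_add]
  split_ifs with h
  · subst h
    rw [_root_.bernoulli_one, show (1 : ℚ[X]) = Polynomial.C 1 from rfl, ← Polynomial.C_add]
    norm_num
  · rw [add_zero, two_mul]

lemma GG_mul (a : ℚ[X]) :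
    PowerSeries.rescale a GG * (PowerSeries.rescale a (PowerSeries.exp ℚ[X]) - 1)
      = PowerSeries.C a * PowerSeries.X * (PowerSeries.rescale a (PowerSeries.exp ℚ[X]) + 1) := by
  have h : GG * (PowerSeries.exp ℚ[X] - 1) = PowerSeries.X * (PowerSeries.exp ℚ[X] + 1) := by
    unfold GG
    linear_combination 2 * bernoulliPowerSeries_mul_exp_sub_one ℚ[X]
  have h2 := congrArg (PowerSeries.rescale a) h
  simpa only [map_mul, map_sub, map_add, map_one, PowerSeries.rescale_X] using h2

lemma exp_ne (a : ℚ[X]) (ha : a ≠ 0) :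
    PowerSeries.rescale a (PowerSeries.exp ℚ[X]) - 1 ≠ 0 := by
  intro h
  have := congrArg (PowerSeries.coeff 1) h
  simp [PowerSeries.coeff_rescale, PowerSeries.coeff_one] at this
  exact ha this

lemma GG_identity (a b : ℚ[X]) (ha : a ≠ 0) (hb : b ≠ 0) (hd : a + b ≠ 0) :
    PowerSeries.rescale (a + b) GG * (PowerSeries.C b * PowerSeries.rescale a GG
        + PowerSeries.C a * PowerSeries.rescale b GG)
      = PowerSeries.C (a + b) * (PowerSeries.C (a * b) * PowerSeries.X ^ 2
        + PowerSeries.rescale a GG * PowerSeries.rescale b GG) := by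
  have h1 := GG_mul a
  have h2 := GG_mul b
  have h3 := GG_mul (a + b)
  have n3 := exp_ne _ hd
  rw [← PowerSeries.exp_mul_exp_eq_exp_add] at h3 n3
  have n1 := exp_ne _ ha
  have n2 := exp_ne _ hb
  rw [map_add PowerSeries.C] at h3 ⊢
  rw [map_mul]
  generalize PowerSeries.rescale (a + b) GG = D at *
  generalize PowerSeries.rescale a GG = A at *
  generalize PowerSeries.rescale b GG = B at *
  generalize PowerSeries.rescale a (PowerSeries.exp ℚ[X]) = x at *
  generalize PowerSeries.rescale b (PowerSeries.exp ℚ[X]) = y at *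
  generalize PowerSeries.C a = p at *
  generalize PowerSeries.C b = q at *
  generalize (PowerSeries.X : PowerSeries ℚ[X]) = t at *
  apply mul_right_cancel₀ (mul_ne_zero (mul_ne_zero n1 n2) n3)
  linear_combination (q * A * (x - 1) * (y - 1) + p * B * (y - 1) * (x - 1)) * h3
    + (q * (p + q) * t * (x * y + 1) * (y - 1) - (p + q) * B * (y - 1) * (x * y - 1)) * h1
    + (p * (p + q) * t * (x * y + 1) * (x - 1) - (p + q) * p * t * (x + 1) * (x * y - 1)) * h2

lemma coeff_identity (N : ℕ) (hN : 0 < N) (hNe : Even N) :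
    X * ∑ x ∈ antidiagonal N, Polynomial.C (cc (x.1 + 1) * cc (x.2 + 1)) *
        ((X + 1) ^ x.1 * X ^ x.2 + (X + 1) ^ x.1 - X ^ x.1)
      = - (Polynomial.C (cc (N + 2)) * ((X + 1) ^ (N + 2) - ∑ k ∈ range (N + 3), (-X) ^ k)) := by
  have hX1 : (X + 1 : ℚ[X]) ≠ 0 := by
    have := Polynomial.X_add_C_ne_zero (1 : ℚ)
    simpa using this
  have h := GG_identity X 1 X_ne_zero one_ne_zero hX1
  have h1 : PowerSeries.C 1 * (PowerSeries.rescale (X + 1) GG * PowerSeries.rescale X GG)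
      + PowerSeries.C X * (PowerSeries.rescale (X + 1) GG * PowerSeries.rescale 1 GG)
      - PowerSeries.C (X + 1) * (PowerSeries.rescale X GG * PowerSeries.rescale 1 GG)
      = PowerSeries.C ((X + 1) * (X * 1)) * PowerSeries.X ^ 2 := by
    rw [map_mul PowerSeries.C (X + 1)]
    linear_combination h
  have h2 := congrArg (PowerSeries.coeff (N + 2)) h1
  rw [map_sub, map_add, PowerSeries.coeff_C_mul, PowerSeries.coeff_C_mul, PowerSeries.coeff_C_mul,
    PowerSeries.coeff_C_mul] at h2
  simp only [PowerSeries.coeff_mul,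
    PowerSeries.coeff_rescale, GG_coeff, PowerSeries.coeff_X_pow] at h2
  rw [if_neg (by omega), mul_zero, mul_sum, mul_sum, mul_sum, ← sum_add_distrib,
    ← sum_sub_distrib] at h2
  have h3 : ∑ x ∈ antidiagonal (N + 2), Polynomial.C (cc x.1 * cc x.2) *
      ((X + 1) ^ x.1 * (X ^ x.2 + X) - (X + 1) * X ^ x.1) = 0 := by
    have h4 : Polynomial.C (4 : ℚ) * ∑ x ∈ antidiagonal (N + 2), Polynomial.C (cc x.1 * cc x.2) *
      ((X + 1) ^ x.1 * (X ^ x.2 + X) - (X + 1) * X ^ x.1) = 0 := by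
      rw [← h2, mul_sum]
      refine sum_congr rfl fun x _ => ?_
      rw [show (4 : ℚ) = 2 * 2 by norm_num]
      simp only [Polynomial.C_mul, one_pow, one_mul]
      ring
    rcases mul_eq_zero.1 h4 with h5 | h5
    · exact absurd h5 (by simp)
    · exact h5
  rw [Finset.Nat.sum_antidiagonal_succ, Finset.Nat.sum_antidiagonal_succ'] at h3
  have c0 : cc 0 = 1 := by simp [cc]
  simp only [c0, one_mul, mul_one, pow_zero] at h3
  have hgeom : (X + 1 : ℚ[X]) * ∑ k ∈ range (N + 3), (-X : ℚ[X]) ^ k = X ^ (N + 3) + 1 := by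
    have := mul_neg_geom_sum (-X : ℚ[X]) (N + 3)
    have ho : Odd (N + 3) := by
      rcases hNe with ⟨k, hk⟩
      exact ⟨k + 1, by omega⟩
    rw [ho.neg_pow] at this
    linear_combination this
  apply mul_left_cancel₀ hX1
  have hs : ∑ x ∈ antidiagonal N, Polynomial.C (cc (x.1 + 1) * cc (x.2 + 1)) *
      ((X + 1) ^ (x.1 + 1) * (X ^ (x.2 + 1) + X) - (X + 1) * X ^ (x.1 + 1))
      = (X + 1) * (X * ∑ x ∈ antidiagonal N, Polynomial.C (cc (x.1 + 1) * cc (x.2 + 1)) *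
        ((X + 1) ^ x.1 * X ^ x.2 + (X + 1) ^ x.1 - X ^ x.1)) := by
    rw [mul_sum, mul_sum]
    refine sum_congr rfl fun x _ => ?_
    ring
  rw [← hs]
  linear_combination h3 - Polynomial.C (cc (N + 2)) * hgeom

lemma rat_identity {n : ℕ} (hn : 0 < n) (hne : Even n) :
    ∑ k ∈ range (n + 1), (n.choose k : ℚ) * (_root_.bernoulli (n + k + 1) / (n + k + 1)) *
        (_root_.bernoulli (2 * n - k + 1) / (2 * n - k + 1))
      = - (n.factorial ^ 2 / (2 * n + 1).factorial *
          (_root_.bernoulli (3 * n + 2) / (3 * n + 2))) := by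
  have hcc : ∀ m : ℕ, 0 < m → cc (m + 1) * m.factorial = _root_.bernoulli (m + 1) / (m + 1) := by
    intro m hm
    have := Nat.factorial_ne_zero m
    rw [cc, if_neg (by omega), Nat.factorial_succ]
    push_cast
    field_simp
  have hcc0 : ∀ m : ℕ, Even m → cc (m + 1) = 0 := by
    intro m hm
    unfold cc
    split_ifs with h
    · rfl
    · rw [_root_.bernoulli_eq_zero_of_odd hm.add_one (by omega), zero_div]
  have hP := coeff_identity (3 * n) (by omega) (hne.mul_left 3)
  have h1 : ∑ l ∈ range (n + 1), ww n l * (X * ∑ x ∈ antidiagonal (3 * n),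
      Polynomial.C (cc (x.1 + 1) * cc (x.2 + 1)) *
        ((X + 1) ^ x.1 * X ^ x.2 + (X + 1) ^ x.1 - X ^ x.1) : ℚ[X]).coeff (n + l + 1)
      = 3 * ∑ x ∈ antidiagonal (3 * n), (cc (x.1 + 1) * x.1.factorial) *
        (cc (x.2 + 1) * x.2.factorial) * ch n x.2 := by
    simp only [coeff_X_mul, finsetSum_coeff, coeff_C_mul, mul_sum]
    rw [sum_comm]
    refine sum_congr rfl fun x hx => ?_
    have hx' := mem_antidiagonal.1 hx
    have e : ∀ l, ww n l * (cc (x.1 + 1) * cc (x.2 + 1) *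
        ((X + 1) ^ x.1 * X ^ x.2 + (X + 1) ^ x.1 - X ^ x.1 : ℚ[X]).coeff (n + l))
        = cc (x.1 + 1) * cc (x.2 + 1) * (ww n l * ((X + 1 : ℚ[X]) ^ x.1 * X ^ x.2).coeff (n + l)
          + ww n l * ((X + 1 : ℚ[X]) ^ x.1).coeff (n + l)
          - ww n l * ((X : ℚ[X]) ^ x.1).coeff (n + l)) := by
      intro l
      rw [coeff_sub, coeff_add]
      ring
    simp only [e]
    rw [← mul_sum, sum_sub_distrib, sum_add_distrib, ph1 hne hx', ph2 hne hx', ph3 hne hx',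
      ch_symm hx']
    rcases Nat.even_or_odd x.1 with h | h
    · rw [hcc0 _ h]; ring
    · rw [h.neg_one_pow]; ring
  have h2 : ∑ l ∈ range (n + 1), ww n l * (- (Polynomial.C (cc (3 * n + 2)) *
      ((X + 1) ^ (3 * n + 2) - ∑ k ∈ range (3 * n + 3), (-X) ^ k)) : ℚ[X]).coeff (n + l + 1)
      = - (cc (3 * n + 2) *
        (3 * (n.factorial ^ 2 * (3 * n + 1).factorial / (2 * n + 1).factorial))) := by
    rw [← final_sum hne, mul_sum, ← sum_neg_distrib]
    refine sum_congr rfl fun l hl => ?_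
    have hl' : l ≤ n := by simpa [Nat.lt_succ_iff] using hl
    have e : (∑ k ∈ range (3 * n + 3), (-X : ℚ[X]) ^ k).coeff (n + l + 1) = - (-1) ^ l := by
      have e1 : ∀ k, (-X : ℚ[X]) ^ k = Polynomial.C ((-1) ^ k) * X ^ k := by
        intro k
        rw [neg_pow]; simp
      simp only [e1, finsetSum_coeff, coeff_C_mul, coeff_X_pow, mul_ite, mul_one, mul_zero]
      rw [sum_ite_eq, if_pos (by simp; omega), pow_succ, pow_add, hne.neg_one_pow]
      ring
    rw [coeff_neg, coeff_C_mul, coeff_sub, e, coeff_X_add_one_pow]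
    ring
  rw [hP, h2] at h1
  have h3 : ∑ x ∈ antidiagonal (3 * n), (cc (x.1 + 1) * x.1.factorial) *
        (cc (x.2 + 1) * x.2.factorial) * ch n x.2 =
      ∑ k ∈ range (n + 1), (n.choose k : ℚ) * (_root_.bernoulli (n + k + 1) / (n + k + 1)) *
        (_root_.bernoulli (2 * n - k + 1) / (2 * n - k + 1)) := by
    rw [Finset.Nat.sum_antidiagonal_eq_sum_range_succ_mk]
    rw [← sum_range_reflect, show (3 * n).succ = n + ((n + 1) + n) by omega, sum_range_add,
      sum_range_add]
    rw [sum_eq_zero (s := range n), sum_eq_zero (s := range n), zero_add, add_zero]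
    · refine sum_congr rfl fun l hl => ?_
      have hl' : l ≤ n := by simpa [Nat.lt_succ_iff] using hl
      simp only []
      rw [show n + (n + 1 + n) - 1 - (n + l) = 2 * n - l by omega,
        show 3 * n - (2 * n - l) = n + l by omega, hcc _ (by omega), hcc _ (by omega), ch,
        if_pos (by omega), Nat.add_sub_cancel_left]
      push_cast [Nat.cast_sub (show l ≤ 2 * n by omega)]
      ring
    · intro l hl
      have hl' : l < n := by simpa using hl
      simp only []
      rw [ch, if_pos (by omega), Nat.choose_eq_zero_of_lt (by omega)]
      simp
    · intro l hl
      have hl' : l < n := by simpa using hl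
      simp only []
      rw [ch, if_neg (by omega)]
      simp
  have h4 := hcc (3 * n + 1) (by omega)
  push_cast at h4
  rw [h3] at h1
  rw [show (3 * n + 2 : ℚ) = 3 * n + 1 + 1 by ring, ← h4]
  linear_combination (-1 / 3 : ℚ) * h1

lemma zeta_val (m : ℕ) (hm : 0 < m) :
    riemannZeta (-(m : ℂ)) = ((-(_root_.bernoulli (m + 1) / (m + 1)) : ℚ) : ℂ) := by
  rw [riemannZeta_neg_nat_eq_bernoulli']
  rw [← bernoulli_eq_bernoulli'_of_ne_one (by omega)]
  push_cast
  ring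

end ZetaNeg

/-- For every positive even integer `n`,
`∑_{k=0}^{n} ζ(-n-k) ζ(-2n+k) / (k! (n-k)!) = (n!/(2n+1)!) ζ(-3n-1)`. -/
theorem riemannZeta_negative_values_identity (n : ℕ) (hn : 0 < n) (hne : Even n) :
    ∑ k ∈ Finset.range (n + 1),
        (1 / ((k.factorial : ℂ) * ((n - k).factorial : ℂ)))
          * riemannZeta (-(n : ℂ) - (k : ℂ)) * riemannZeta (-2 * (n : ℂ) + (k : ℂ))
      = ((n.factorial : ℂ) / ((2 * n + 1).factorial : ℂ)) * riemannZeta (-3 * (n : ℂ) - 1) := by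
  have h := congrArg (Rat.cast : ℚ → ℂ) (ZetaNeg.rat_identity hn hne)
  have hnf : (n.factorial : ℂ) ≠ 0 := by exact_mod_cast Nat.factorial_ne_zero n
  have hz : riemannZeta (-3 * (n : ℂ) - 1)
      = ((-(_root_.bernoulli (3 * n + 2) / (3 * n + 2)) : ℚ) : ℂ) := by
    have := ZetaNeg.zeta_val (3 * n + 1) (by omega)
    rw [show -3 * (n : ℂ) - 1 = -((3 * n + 1 : ℕ) : ℂ) by push_cast; ring, this]
    push_cast
    ring
  have hL : (n.factorial : ℂ) * ∑ k ∈ Finset.range (n + 1),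
        (1 / ((k.factorial : ℂ) * ((n - k).factorial : ℂ)))
          * riemannZeta (-(n : ℂ) - (k : ℂ)) * riemannZeta (-2 * (n : ℂ) + (k : ℂ))
      = ((∑ k ∈ Finset.range (n + 1), (n.choose k : ℚ) * (bernoulli (n + k + 1) / (n + k + 1)) *
        (bernoulli (2 * n - k + 1) / (2 * n - k + 1)) : ℚ) : ℂ) := by
    rw [Finset.mul_sum, Rat.cast_sum]
    refine Finset.sum_congr rfl fun k hk => ?_
    have hk' : k ≤ n := by simpa [Nat.lt_succ_iff] using hk
    have z1 := ZetaNeg.zeta_val (n + k) (by omega)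
    have z2 := ZetaNeg.zeta_val (2 * n - k) (by omega)
    rw [show -(n : ℂ) - (k : ℂ) = -((n + k : ℕ) : ℂ) by push_cast; ring, z1,
      show -2 * (n : ℂ) + (k : ℂ) = -((2 * n - k : ℕ) : ℂ) by
        push_cast [Nat.cast_sub (show k ≤ 2 * n by omega)]; ring, z2]
    have a3' : (n.choose k : ℂ) * k.factorial * (n - k).factorial = n.factorial := by
      exact_mod_cast Nat.choose_mul_factorial_mul_factorial hk'
    have f1 : (k.factorial : ℂ) ≠ 0 := by exact_mod_cast Nat.factorial_ne_zero k
    have f2 : ((n - k).factorial : ℂ) ≠ 0 := by exact_mod_cast Nat.factorial_ne_zero (n - k)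
    have a4 : (n.factorial : ℂ) * (1 / ((k.factorial : ℂ) * ((n - k).factorial : ℂ)))
        = n.choose k := by
      rw [← a3']; field_simp
    rw [← mul_assoc, ← mul_assoc, a4]
    push_cast [Nat.cast_sub (show k ≤ 2 * n by omega)]
    ring
  apply mul_left_cancel₀ hnf
  rw [hL, h, hz]
  push_cast
  ring
end

section
/- For every positive even integer n, Σ_{k=0}^{n} (1/(k!·(n−k)!))·(B_{n+1+k}/(n+1+k))·(B_{2n+1−k}/(2n+1−k)) = −(n!/(2n+1)!)·(B_{3n+2}/(3n+2)), where B_j denotes the j-th Bernoulli number (as a rational number). -/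
/-- modified Bernoulli coefficients -/
noncomputable def bcf (i : ℕ) : ℚ := if i = 1 then 0 else bernoulli i / (i.factorial : ℚ)


noncomputable def bser (R : Type*) [CommRing R] [Algebra ℚ R] : PowerSeries R :=
  PowerSeries.mk fun i => algebraMap ℚ R (bcf i)

theorem bser_eq {R : Type*} [CommRing R] [Algebra ℚ R] : bser R = bernoulliPowerSeries R +
    PowerSeries.C (algebraMap ℚ R (1/2)) * PowerSeries.X := by
  ext i
  simp only [bser, bernoulliPowerSeries, PowerSeries.coeff_mk, map_add, PowerSeries.coeff_C_mul,
    PowerSeries.coeff_X, bcf]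
  split_ifs with h
  · subst h
    rw [mul_one, ← map_add]; norm_num
  · simp

theorem bser_mul {R : Type*} [CommRing R] [Algebra ℚ R] (x : R) : (PowerSeries.rescale x (bser R)) * (2 * (PowerSeries.rescale x (PowerSeries.exp R) - 1))
    = PowerSeries.C x * PowerSeries.X * (PowerSeries.rescale x (PowerSeries.exp R) + 1) := by
  have h := congrArg (PowerSeries.rescale x) (bernoulliPowerSeries_mul_exp_sub_one R)
  rw [map_mul, map_sub, map_one, PowerSeries.rescale_X] at h
  have h2 : (2 : PowerSeries R) * PowerSeries.C (algebraMap ℚ R (1/2)) = 1 := by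
    have : (2 : PowerSeries R) = PowerSeries.C (algebraMap ℚ R 2) := by rw [map_ofNat, map_ofNat]
    rw [this, ← map_mul, ← map_mul]; norm_num
  have hC : PowerSeries.rescale x (PowerSeries.C (algebraMap ℚ R (1/2))) = PowerSeries.C (algebraMap ℚ R (1/2)) := by
    ext i
    rw [PowerSeries.coeff_rescale, PowerSeries.coeff_C]
    split_ifs with h <;> simp [h]
  rw [bser_eq, map_add, map_mul, hC, PowerSeries.rescale_X]
  linear_combination 2 * h + PowerSeries.C x * PowerSeries.X * (PowerSeries.rescale x (PowerSeries.exp R) - 1) * h2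

theorem exp_sub_ne {R : Type*} [CommRing R] [Algebra ℚ R] (x : R) (hx : x ≠ 0) : (PowerSeries.rescale x (PowerSeries.exp R) - 1) ≠ 0 := by
  intro h
  have := congrArg (PowerSeries.coeff 1) h
  simp [PowerSeries.coeff_rescale, PowerSeries.coeff_exp, PowerSeries.coeff_one] at this
  exact hx this

theorem bser_rel {R : Type*} [CommRing R] [IsDomain R] [Algebra ℚ R] (x y z : R) (hx : x ≠ 0) (hy : y ≠ 0) (hz : z ≠ 0) (h : x + y + z = 0) :
    4 * (PowerSeries.C z * (PowerSeries.rescale x (bser R) * PowerSeries.rescale y (bser R))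
     + PowerSeries.C x * (PowerSeries.rescale y (bser R) * PowerSeries.rescale z (bser R))
     + PowerSeries.C y * (PowerSeries.rescale z (bser R) * PowerSeries.rescale x (bser R)))
     = - PowerSeries.C (x * y * z) * PowerSeries.X ^ 2 := by
  have ha := bser_mul x
  have hb := bser_mul y
  have hc := bser_mul z
  have ea := exp_sub_ne x hx
  have eb := exp_sub_ne y hy
  have ec := exp_sub_ne z hz
  have he : PowerSeries.rescale x (PowerSeries.exp R) * PowerSeries.rescale y (PowerSeries.exp R) * PowerSeries.rescale z (PowerSeries.exp R) = 1 := by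
    rw [PowerSeries.exp_mul_exp_eq_exp_add, PowerSeries.exp_mul_exp_eq_exp_add, h]
    ext i
    rw [PowerSeries.coeff_rescale, PowerSeries.coeff_one]
    split_ifs with h <;> simp [h]
  rw [map_mul, map_mul]
  generalize PowerSeries.rescale x (PowerSeries.exp R) = Ex at *
  generalize PowerSeries.rescale y (PowerSeries.exp R) = Ey at *
  generalize PowerSeries.rescale z (PowerSeries.exp R) = Ez at *
  generalize PowerSeries.rescale x (bser R) = Fx at *
  generalize PowerSeries.rescale y (bser R) = Fy at *
  generalize PowerSeries.rescale z (bser R) = Fz at *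
  generalize PowerSeries.C x = cx at *
  generalize PowerSeries.C y = cy at *
  generalize PowerSeries.C z = cz at *
  have hne : (Ex - 1) * (Ey - 1) * (Ez - 1) ≠ 0 := mul_ne_zero (mul_ne_zero ea eb) ec
  apply mul_right_cancel₀ hne
  have hab : Fx * (2 * (Ex - 1)) * (Fy * (2 * (Ey - 1))) = _ := congrArg₂ (· * ·) ha hb
  have hbc : Fy * (2 * (Ey - 1)) * (Fz * (2 * (Ez - 1))) = _ := congrArg₂ (· * ·) hb hc
  have hca : Fz * (2 * (Ez - 1)) * (Fx * (2 * (Ex - 1))) = _ := congrArg₂ (· * ·) hc ha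
  linear_combination cz * (Ez - 1) * hab + cx * (Ex - 1) * hbc + cy * (Ey - 1) * hca + 4 * cx * cy * cz * PowerSeries.X ^ 2 * he

theorem coeff_rel {R : Type*} [CommRing R] [IsDomain R] [Algebra ℚ R] (x y z : R) (hx : x ≠ 0) (hy : y ≠ 0) (hz : z ≠ 0) (h : x + y + z = 0)
    (N : ℕ) (hN : 0 < N) (hNe : Even N) :
    ∑ p ∈ Finset.HasAntidiagonal.antidiagonal N, algebraMap ℚ R (bcf (p.1 + 1) * bcf (p.2 + 1)) *
      (x ^ p.1 * y ^ p.2 + y ^ p.1 * z ^ p.2 + z ^ p.1 * x ^ p.2)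
    = algebraMap ℚ R (bcf (N + 2)) * ∑ p ∈ Finset.HasAntidiagonal.antidiagonal N, (-1) ^ p.1 *
      (x ^ p.1 * y ^ p.2 + y ^ p.1 * z ^ p.2 + z ^ p.1 * x ^ p.2) := by
  have h0 : bcf 0 = 1 := by simp [bcf]
  have key : ∀ u v : R, PowerSeries.coeff (N + 2) (PowerSeries.rescale u (bser R) * PowerSeries.rescale v (bser R))
      = algebraMap ℚ R (bcf (N + 2)) * (u ^ (N + 2) + v ^ (N + 2)) + u * v * ∑ p ∈ Finset.HasAntidiagonal.antidiagonal N,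
        algebraMap ℚ R (bcf (p.1 + 1) * bcf (p.2 + 1)) * (u ^ p.1 * v ^ p.2) := by
    intro u v
    rw [PowerSeries.coeff_mul, Finset.Nat.sum_antidiagonal_succ, Finset.Nat.sum_antidiagonal_succ', Finset.mul_sum]
    simp only [PowerSeries.coeff_rescale, bser, PowerSeries.coeff_mk, h0, map_one, map_mul]
    have : ∀ p : ℕ × ℕ, u ^ (p.1 + 1) * algebraMap ℚ R (bcf (p.1 + 1)) * (v ^ (p.2 + 1) * algebraMap ℚ R (bcf (p.2 + 1)))
       = u * v * ((algebraMap ℚ R (bcf (p.1 + 1)) * algebraMap ℚ R (bcf (p.2 + 1))) * (u ^ p.1 * v ^ p.2)) := by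
      intro p; ring
    simp only [this]
    ring
  have alt : ∀ u v : R, (u + v) * ∑ p ∈ Finset.HasAntidiagonal.antidiagonal N, (-1) ^ p.1 * (u ^ p.1 * v ^ p.2)
      = u ^ (N + 1) + v ^ (N + 1) := by
    intro u v
    have := (Commute.all (-u) v).geom_sum₂_mul (N + 1)
    rw [Finset.Nat.sum_antidiagonal_eq_sum_range_succ_mk]
    have e : ∑ k ∈ Finset.range N.succ, (-1) ^ k * (u ^ k * v ^ (N - k)) = ∑ i ∈ Finset.range (N + 1), (-u) ^ i * v ^ (N + 1 - 1 - i) := by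
      apply Finset.sum_congr rfl
      intro k _
      rw [neg_pow u k]; simp; ring
    simp only
    rw [e]
    have e2 : (-u) ^ (N + 1) = - u ^ (N + 1) := (Even.add_one hNe).neg_pow u
    rw [e2] at this
    linear_combination - this
  have hr := congrArg (PowerSeries.coeff (N + 2)) (bser_rel x y z hx hy hz h)
  have h4 : (4 : PowerSeries R) = PowerSeries.C 4 := by rw [map_ofNat]
  rw [h4, ← map_neg, PowerSeries.coeff_C_mul, PowerSeries.coeff_C_mul, PowerSeries.coeff_X_pow, if_neg (by omega)] at hr
  simp only [map_add, PowerSeries.coeff_C_mul, key] at hr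
  simp only [mul_add, Finset.sum_add_distrib]
  have a1 := alt x y
  have a2 := alt y z
  have a3 := alt z x
  generalize ∑ p ∈ Finset.HasAntidiagonal.antidiagonal N, (-1) ^ p.1 * (x ^ p.1 * y ^ p.2) = A1 at *
  generalize ∑ p ∈ Finset.HasAntidiagonal.antidiagonal N, (-1) ^ p.1 * (y ^ p.1 * z ^ p.2) = A2 at *
  generalize ∑ p ∈ Finset.HasAntidiagonal.antidiagonal N, (-1) ^ p.1 * (z ^ p.1 * x ^ p.2) = A3 at *
  generalize ∑ p ∈ Finset.HasAntidiagonal.antidiagonal N, algebraMap ℚ R (bcf (p.1 + 1) * bcf (p.2 + 1)) * (x ^ p.1 * y ^ p.2) = B1 at *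
  generalize ∑ p ∈ Finset.HasAntidiagonal.antidiagonal N, algebraMap ℚ R (bcf (p.1 + 1) * bcf (p.2 + 1)) * (y ^ p.1 * z ^ p.2) = B2 at *
  generalize ∑ p ∈ Finset.HasAntidiagonal.antidiagonal N, algebraMap ℚ R (bcf (p.1 + 1) * bcf (p.2 + 1)) * (z ^ p.1 * x ^ p.2) = B3 at *
  generalize algebraMap ℚ R (bcf (N + 2)) = b at *
  have : CharZero R := algebraRat.charZero R
  have h40 : (4 : R) ≠ 0 := by norm_num
  apply mul_left_cancel₀ (mul_ne_zero h40 (mul_ne_zero (mul_ne_zero hx hy) hz))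
  have hxz : z = -(x + y) := by linear_combination h
  subst hxz
  linear_combination hr + 4 * b * (x * y * a1 + y * (-(x+y)) * a2 + (-(x+y)) * x * a3)

noncomputable def wgt (n k : ℕ) : ℚ :=
  ((n + k).factorial : ℚ) * ((2 * n - k).factorial : ℚ) / ((k.factorial : ℚ) * ((n - k).factorial : ℚ))

noncomputable def pairL (n : ℕ) (p : Polynomial ℚ) : ℚ :=
  ∑ k ∈ Finset.range (n + 1), ((-1) ^ k * wgt n k) * p.coeff (n + k)

theorem pairL_add (n : ℕ) (p q : Polynomial ℚ) : pairL n (p + q) = pairL n p + pairL n q := by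
  simp [pairL, mul_add, Finset.sum_add_distrib]

theorem pairL_C_mul (n : ℕ) (c : ℚ) (p : Polynomial ℚ) :
    pairL n (Polynomial.C c * p) = c * pairL n p := by
  simp only [pairL, Polynomial.coeff_C_mul, Finset.mul_sum]
  exact Finset.sum_congr rfl fun k _ => by ring

theorem pairL_sum {ι : Type*} (n : ℕ) (s : Finset ι) (f : ι → Polynomial ℚ) :
    pairL n (∑ i ∈ s, f i) = ∑ i ∈ s, pairL n (f i) := by
  simp only [pairL, Polynomial.finsetSum_coeff, Finset.mul_sum]
  exact Finset.sum_comm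

theorem alt_choose (n a : ℕ) : ∑ k ∈ Finset.range (n + 1), (-1 : ℤ) ^ k * (n.choose k : ℤ) * ((2 * n - k).choose a : ℤ)
    = if n ≤ a then (n.choose (a - n) : ℤ) else 0 := by
  have h := fwdDiff_iter_eq_sum_shift (1 : ℕ) (fun x ↦ (x.choose a : ℤ)) n n
  have h1 : ∑ k ∈ Finset.range (n + 1), (-1 : ℤ) ^ k * (n.choose k : ℤ) * ((2 * n - k).choose a : ℤ)
      = (fwdDiff 1)^[n] (fun x ↦ (x.choose a : ℤ)) n := by
    rw [h, ← Finset.sum_range_reflect]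
    apply Finset.sum_congr rfl
    intro k hk
    have hk' : k ≤ n := by simpa [Nat.lt_succ_iff] using hk
    have e1 : n + 1 - 1 - k = n - k := by omega
    have e2 : 2 * n - (n - k) = n + k • 1 := by simp; omega
    rw [e1, e2, Nat.choose_symm hk']
    simp
  rw [h1]
  split_ifs with hna
  · obtain ⟨j, rfl⟩ := Nat.exists_eq_add_of_le hna
    rw [fwdDiff_iter_choose]; simp
  · obtain ⟨j, rfl⟩ : ∃ j, n = (j + 1) + a := ⟨n - a - 1, by omega⟩
    rw [Function.iterate_add_apply]
    have := fwdDiff_iter_choose 0 a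
    rw [add_zero] at this
    rw [this]
    simp only [Nat.choose_zero_right, Nat.cast_one, Function.iterate_succ_apply, fwdDiff_const]
    rw [fwdDiff_iter_eq_sum_shift]; simp

theorem wgt_choose (n a b k : ℕ) (hab : a + b = 3 * n) (hk : k ≤ n) :
    wgt n k * (b.choose (n + k) : ℚ) =
      (b.factorial : ℚ) * (a.factorial : ℚ) / (n.factorial : ℚ) * ((n.choose k : ℚ) * ((2 * n - k).choose a : ℚ)) := by
  by_cases h : n + k ≤ b
  · have h2 : a ≤ 2 * n - k := by omega
    have e : 2 * n - k - a = b - (n + k) := by omega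
    rw [wgt, Nat.cast_choose ℚ h, Nat.cast_choose ℚ h2, Nat.cast_choose ℚ hk, e]
    have f := fun m => (Nat.cast_ne_zero (R := ℚ)).2 (Nat.factorial_ne_zero m)
    have f1 := f n
    have f2 := f k
    have f3 := f (n - k)
    have f4 := f (n + k)
    have f5 := f (b - (n + k))
    have f6 := f a
    field_simp
  · rw [Nat.choose_eq_zero_of_lt (by omega : b < n + k), Nat.choose_eq_zero_of_lt (by omega : 2 * n - k < a)]
    simp

theorem pairL_X (n a : ℕ) : pairL n (Polynomial.X ^ a) =
    if n ≤ a ∧ a ≤ 2 * n then (-1) ^ (a - n) * wgt n (a - n) else 0 := by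
  simp only [pairL, Polynomial.coeff_X_pow]
  split_ifs with h
  · rw [Finset.sum_eq_single (a - n)]
    · rw [if_pos (by omega)]; simp
    · intro k _ hk
      rw [if_neg (by omega)]; simp
    · intro hk
      simp at hk; omega
  · apply Finset.sum_eq_zero
    intro k hk
    simp at hk
    rw [if_neg (by omega)]; simp

theorem pairL_two (n a b : ℕ) (hn : Even n) (hab : a + b = 3 * n) :
    ∑ k ∈ Finset.range (n + 1), ((-1) ^ k * wgt n k) * (b.choose (n + k) : ℚ) = (-1) ^ b * pairL n (Polynomial.X ^ a) := by
  have h1 : ∑ k ∈ Finset.range (n + 1), ((-1) ^ k * wgt n k) * (b.choose (n + k) : ℚ)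
      = (b.factorial : ℚ) * (a.factorial : ℚ) / (n.factorial : ℚ) *
        ((∑ k ∈ Finset.range (n + 1), (-1 : ℤ) ^ k * (n.choose k : ℤ) * ((2 * n - k).choose a : ℤ) : ℤ) : ℚ) := by
    push_cast
    rw [Finset.mul_sum]
    apply Finset.sum_congr rfl
    intro k hk
    have hk' : k ≤ n := by simpa [Nat.lt_succ_iff] using hk
    rw [mul_assoc, wgt_choose n a b k hab hk']
    ring
  rw [h1, alt_choose, pairL_X]
  by_cases hna : n ≤ a
  · rw [if_pos hna]
    by_cases h2 : a ≤ 2 * n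
    · rw [if_pos ⟨hna, h2⟩, ← mul_assoc, ← pow_add]
      have hev : Even (b + (a - n)) := by
        rw [show b + (a - n) = 2 * n by omega]; exact even_two_mul n
      rw [hev.neg_one_pow, wgt, show n + (a - n) = a by omega, show 2 * n - (a - n) = b by omega]
      rw [Int.cast_natCast, Nat.cast_choose ℚ (by omega : a - n ≤ n)]
      have f := fun m => (Nat.cast_ne_zero (R := ℚ)).2 (Nat.factorial_ne_zero m)
      have f1 := f n
      have f2 := f (a - n)
      have f3 := f (n - (a - n))
      field_simp
    · rw [if_neg (by omega), Nat.choose_eq_zero_of_lt (by omega)]; simp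
  · rw [if_neg hna, if_neg (by omega)]; simp

theorem pairL_second (n a b : ℕ) (hn : Even n) (hab : a + b = 3 * n) :
    pairL n (1 ^ a * (-1 - Polynomial.X) ^ b) = pairL n (Polynomial.X ^ a * 1 ^ b) := by
  have e : (1 ^ a * (-1 - Polynomial.X) ^ b : Polynomial ℚ) = Polynomial.C ((-1) ^ b) * (1 + Polynomial.X) ^ b := by
    rw [show (-1 - Polynomial.X : Polynomial ℚ) = -(1 + Polynomial.X) by ring, neg_pow]; simp
  rw [e, pairL_C_mul, one_pow, mul_one]
  have : pairL n ((1 + Polynomial.X) ^ b) = (-1) ^ b * pairL n (Polynomial.X ^ a) := by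
    rw [← pairL_two n a b hn hab]
    simp only [pairL, Polynomial.coeff_one_add_X_pow]
  rw [this, ← mul_assoc, ← mul_pow]; simp

theorem wgt_symm (n k : ℕ) (hk : k ≤ n) : wgt n (n - k) = wgt n k := by
  simp only [wgt]
  rw [show n + (n - k) = 2 * n - k by omega, show 2 * n - (n - k) = n + k by omega,
    show n - (n - k) = k by omega]
  ring

theorem pairL_swap (n a b : ℕ) (hn : Even n) (hab : a + b = 3 * n) :
    pairL n (Polynomial.X ^ b) = pairL n (Polynomial.X ^ a) := by
  rw [pairL_X, pairL_X]
  by_cases h : n ≤ a ∧ a ≤ 2 * n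
  · rw [if_pos h, if_pos (by omega), show b - n = n - (a - n) by omega, wgt_symm _ _ (by omega)]
    congr 1
    have : ((-1 : ℚ)) ^ (n - (a - n)) * (-1) ^ (a - n) = 1 := by
      rw [← pow_add, show n - (a - n) + (a - n) = n by omega, hn.neg_one_pow]
    rcases neg_one_pow_eq_or ℚ (a - n) with h | h <;> rw [h] at this ⊢ <;> linarith
  · rw [if_neg h, if_neg (by omega)]

theorem pairL_third (n a b : ℕ) (hn : Even n) (hab : a + b = 3 * n) :
    pairL n ((-1 - Polynomial.X) ^ a * Polynomial.X ^ b) = pairL n (Polynomial.X ^ a * 1 ^ b) := by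
  have e : ((-1 - Polynomial.X) ^ a * Polynomial.X ^ b : Polynomial ℚ) = Polynomial.C ((-1) ^ a) * ((1 + Polynomial.X) ^ a * Polynomial.X ^ b) := by
    rw [show (-1 - Polynomial.X : Polynomial ℚ) = -(1 + Polynomial.X) by ring, neg_pow]; simp; ring
  rw [e, pairL_C_mul, one_pow, mul_one]
  have : pairL n ((1 + Polynomial.X) ^ a * Polynomial.X ^ b) = (-1) ^ a * pairL n (Polynomial.X ^ a) := by
    rw [← pairL_swap n a b hn hab, ← pairL_two n b a hn (by omega)]
    rw [← Finset.sum_range_reflect]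
    apply Finset.sum_congr rfl
    intro k hk
    have hk' : k ≤ n := by simpa [Nat.lt_succ_iff] using hk
    rw [show n + 1 - 1 - k = n - k by omega, wgt_symm n k hk', Polynomial.coeff_mul_X_pow', Polynomial.coeff_one_add_X_pow]
    have hs : ((-1 : ℚ)) ^ (n - k) = (-1) ^ k := by
      have : ((-1 : ℚ)) ^ (n - k) * (-1) ^ k = 1 := by
        rw [← pow_add, show n - k + k = n by omega, hn.neg_one_pow]
      rcases neg_one_pow_eq_or ℚ k with h | h <;> rw [h] at this ⊢ <;> linarith
    rw [hs]
    split_ifs with hb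
    · congr 2
      rw [← Nat.choose_symm_of_eq_add]
      omega
    · rw [Nat.choose_eq_zero_of_lt (by omega)]; simp
  rw [this, ← mul_assoc, ← mul_pow]; simp

theorem wgt_sum (n : ℕ) : ∑ k ∈ Finset.range (n + 1), wgt n k =
    (n.factorial : ℚ) * ((3 * n + 1).factorial : ℚ) / ((2 * n + 1).factorial : ℚ) := by
  have h := congrArg (fun u => PowerSeries.coeff n (Units.val u)) (PowerSeries.invOneSubPow_add ℚ (n + 1) (n + 1))
  simp only [Units.val_mul] at h
  rw [show n + 1 + (n + 1) = (2 * n + 1) + 1 by ring, PowerSeries.invOneSubPow_val_succ_eq_mk_add_choose,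
    PowerSeries.invOneSubPow_val_succ_eq_mk_add_choose, PowerSeries.coeff_mul, PowerSeries.coeff_mk,
    Finset.Nat.sum_antidiagonal_eq_sum_range_succ_mk] at h
  simp only [PowerSeries.coeff_mk] at h
  have f := fun m => (Nat.cast_ne_zero (R := ℚ)).2 (Nat.factorial_ne_zero m)
  have e : ∀ k ∈ Finset.range (n + 1), wgt n k = (n.factorial : ℚ) ^ 2 * (((n + k).choose n : ℚ) * ((n + (n - k)).choose n : ℚ)) := by
    intro k hk
    have hk' : k ≤ n := by simpa [Nat.lt_succ_iff] using hk
    rw [Nat.cast_choose ℚ (by omega : n ≤ n + k), Nat.cast_choose ℚ (by omega : n ≤ n + (n - k)), wgt,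
      show n + k - n = k by omega, show n + (n - k) - n = n - k by omega, show n + (n - k) = 2 * n - k by omega]
    have f1 := f n
    have f2 := f k
    have f3 := f (n - k)
    field_simp
  rw [Finset.sum_congr rfl e, ← Finset.mul_sum, ← h, Nat.cast_choose ℚ (by omega : 2 * n + 1 ≤ 2 * n + 1 + n),
    show 2 * n + 1 + n - (2 * n + 1) = n by omega, show 2 * n + 1 + n = 3 * n + 1 by ring]
  have f1 := f n
  have f2 := f (2 * n + 1)
  field_simp

theorem pairL_antidiag (n : ℕ) (g : ℕ × ℕ → ℚ) :
    ∑ p ∈ Finset.HasAntidiagonal.antidiagonal (3 * n), g p * pairL n (Polynomial.X ^ p.1) =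
    ∑ k ∈ Finset.range (n + 1), (-1) ^ k * wgt n k * g (n + k, 2 * n - k) := by
  simp only [pairL, Finset.mul_sum]
  rw [Finset.sum_comm]
  apply Finset.sum_congr rfl
  intro k hk
  have hk' : k ≤ n := by simpa [Nat.lt_succ_iff] using hk
  rw [Finset.sum_eq_single (n + k, 2 * n - k)]
  · simp; ring
  · rintro ⟨a, b⟩ hp hne
    rw [Finset.HasAntidiagonal.mem_antidiagonal] at hp
    rw [Polynomial.coeff_X_pow, if_neg]
    · simp
    · intro h
      apply hne
      simp only at h hp
      ext <;> simp <;> omega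
  · intro h
    exfalso; apply h
    rw [Finset.HasAntidiagonal.mem_antidiagonal]; simp; omega

theorem main_rel (n : ℕ) (hn : 0 < n) (hne : Even n) :
    ∑ k ∈ Finset.range (n + 1), (-1) ^ k * wgt n k * (bcf (n + k + 1) * bcf (2 * n - k + 1))
    = bcf (3 * n + 2) * ∑ k ∈ Finset.range (n + 1), wgt n k := by
  have hz : (-1 - Polynomial.X : Polynomial ℚ) ≠ 0 := by
    intro h
    have := congrArg (fun p => Polynomial.coeff p 1) h
    simp [Polynomial.coeff_one] at this
  have h := congrArg (pairL n) (coeff_rel (Polynomial.X : Polynomial ℚ) 1 (-1 - Polynomial.X) Polynomial.X_ne_zero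
    one_ne_zero hz (by ring) (3 * n) (by omega) (hne.mul_left 3))
  have key : ∀ p ∈ Finset.HasAntidiagonal.antidiagonal (3 * n), ∀ c : ℚ, pairL n (Polynomial.C c *
      (Polynomial.X ^ p.1 * 1 ^ p.2 + 1 ^ p.1 * (-1 - Polynomial.X) ^ p.2 + (-1 - Polynomial.X) ^ p.1 * Polynomial.X ^ p.2))
      = (3 * c) * pairL n (Polynomial.X ^ p.1) := by
    intro p hp c
    rw [Finset.HasAntidiagonal.mem_antidiagonal] at hp
    rw [pairL_C_mul, pairL_add, pairL_add, pairL_second n _ _ hne hp, pairL_third n _ _ hne hp]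
    simp; ring
  have hneg : ∀ k : ℕ, ((-1 : Polynomial ℚ)) ^ k = Polynomial.C ((-1) ^ k) := by intro k; simp
  simp only [← Polynomial.C_eq_algebraMap] at h
  rw [pairL_C_mul, pairL_sum, pairL_sum] at h
  simp only [hneg] at h
  rw [Finset.sum_congr rfl fun p hp => key p hp _, Finset.sum_congr rfl fun p hp => key p hp _,
    pairL_antidiag, pairL_antidiag] at h
  have e : ∑ k ∈ Finset.range (n + 1), (-1) ^ k * wgt n k * (3 * (-1) ^ (n + k)) = 3 * ∑ k ∈ Finset.range (n + 1), wgt n k := by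
    rw [Finset.mul_sum]
    apply Finset.sum_congr rfl
    intro k _
    rw [pow_add, hne.neg_one_pow]
    rcases neg_one_pow_eq_or ℚ k with h | h <;> rw [h] <;> ring
  simp only at h
  rw [e] at h
  have e2 : ∑ k ∈ Finset.range (n + 1), (-1) ^ k * wgt n k * (3 * (bcf (n + k + 1) * bcf (2 * n - k + 1)))
     = 3 * ∑ k ∈ Finset.range (n + 1), (-1) ^ k * wgt n k * (bcf (n + k + 1) * bcf (2 * n - k + 1)) := by
    rw [Finset.mul_sum]
    exact Finset.sum_congr rfl fun k _ => by ring
  rw [e2] at h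
  linarith

/-- For every positive even integer `n`,
`∑_{k=0}^{n} (B_{n+1+k}/(n+1+k)) (B_{2n+1-k}/(2n+1-k)) / (k! (n-k)!)
  = -(n!/(2n+1)!) (B_{3n+2}/(3n+2))`, where `B_j` is the `j`-th Bernoulli number. -/
theorem bernoulli_convolution_identity (n : ℕ) (hn : 0 < n) (hne : Even n) :
    ∑ k ∈ Finset.range (n + 1),
        (1 / ((k.factorial : ℚ) * ((n - k).factorial : ℚ)))
          * (bernoulli (n + 1 + k) / ((n + 1 + k : ℕ) : ℚ))
          * (bernoulli (2 * n + 1 - k) / ((2 * n + 1 - k : ℕ) : ℚ))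
      = -(((n.factorial : ℚ) / ((2 * n + 1).factorial : ℚ))
          * (bernoulli (3 * n + 2) / ((3 * n + 2 : ℕ) : ℚ))) := by
  have h := main_rel n hn hne
  have f := fun m => (Nat.cast_ne_zero (R := ℚ)).2 (Nat.factorial_ne_zero m)
  have hb : ∀ m : ℕ, 0 < m → bcf (m + 1) * (m.factorial : ℚ) = bernoulli (m + 1) / ((m + 1 : ℕ) : ℚ) := by
    intro m hm
    rw [bcf, if_neg (by omega), Nat.factorial_succ]
    have := f m
    have h2 : ((m + 1 : ℕ) : ℚ) ≠ 0 := by positivity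
    push_cast at h2 ⊢
    field_simp
  have e : ∀ k ∈ Finset.range (n + 1), (1 / ((k.factorial : ℚ) * ((n - k).factorial : ℚ)))
          * (bernoulli (n + 1 + k) / ((n + 1 + k : ℕ) : ℚ))
          * (bernoulli (2 * n + 1 - k) / ((2 * n + 1 - k : ℕ) : ℚ))
      = -((-1) ^ k * wgt n k * (bcf (n + k + 1) * bcf (2 * n - k + 1))) := by
    intro k hk
    have hk' : k ≤ n := by simpa [Nat.lt_succ_iff] using hk
    rw [show n + 1 + k = (n + k) + 1 by omega, show 2 * n + 1 - k = (2 * n - k) + 1 by omega,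
      ← hb (n + k) (by omega), ← hb (2 * n - k) (by omega), wgt]
    rcases Nat.even_or_odd k with hke | hko
    · have : bcf (n + k + 1) = 0 := by
        rw [bcf, if_neg (by omega), bernoulli_eq_zero_of_odd ((hne.add hke).add_one) (by omega)]
        simp
      rw [this]; simp
    · rw [hko.neg_one_pow]
      ring
  rw [Finset.sum_congr rfl e, Finset.sum_neg_distrib, h, wgt_sum, show 3 * n + 2 = (3 * n + 1) + 1 by ring,
    ← hb (3 * n + 1) (by omega)]
  ring
end
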